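/- arXiv:0704.3304 — 3 statements merged into one kernel-verified Lean document; each statement's English description precedes it below -/
import Mathlib

section
/- Every even, continuous, convex-on-[0,∞) function φ: ℝ → [0,1] with φ(0) = 1 and φ(t) → 0 as t → ∞ is the characteristic function of a probability distribution on ℝ (Pólya's criterion). In particular, φ(t) = max(1-|t|, 0) is a characteristic function. -/
open MeasureTheory Set

/-- The characteristic function of a measure `μ` on `ℝ`. -/
noncomputable def cf (μ : Measure ℝ) (t : ℝ) : ℂ :=
  ∫ x, Complex.exp (t * x * Complex.I) ∂μ

/-- `φ` is the characteristic function of some probability distribution on `ℝ`. -/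
def IsCF (φ : ℝ → ℂ) : Prop :=
  ∃ μ : Measure ℝ, IsProbabilityMeasure μ ∧ φ = cf μ

/-- `φ` is the characteristic function of an infinitely divisible distribution on `ℝ`. -/
def IsIDCF (φ : ℝ → ℂ) : Prop :=
  ∀ n : ℕ, 0 < n → ∃ ψ : ℝ → ℂ, IsCF ψ ∧ ∀ t, φ t = ψ t ^ n

/-- `P` is the probability generating function of a distribution on `{0,1,2,...}`:
on `[0,1]` it is given by a power series with nonnegative coefficients summing to `1`. -/
def IsPGF (P : ℝ → ℝ) : Prop :=
  ∃ p : ℕ → ℝ, (∀ n, 0 ≤ p n) ∧ (∑' n, p n) = 1 ∧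
    ∀ s ∈ Icc (0:ℝ) 1, P s = ∑' n, p n * s ^ n

/-- `P` is the PGF of an infinitely divisible distribution on `{0,1,2,...}`:
for every `n ≥ 1`, its `n`-th root (on `[0,1]`) is again a PGF. -/
def IsIDPGF (P : ℝ → ℝ) : Prop :=
  ∀ n : ℕ, 0 < n → ∃ Q : ℝ → ℝ, IsPGF Q ∧ ∀ s ∈ Icc (0:ℝ) 1, P s = Q s ^ n


open Filter Topology FourierTransform

lemma cf_eq_charFun (μ : Measure ℝ) : cf μ = charFun μ := by
  funext t
  rw [charFun_apply_real, cf]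

def IsFCF (ψ : ℝ → ℂ) : Prop := ∃ μ : Measure ℝ, IsFiniteMeasure μ ∧ ψ = charFun μ

lemma IsCF.isFCF {ψ : ℝ → ℂ} (h : IsCF ψ) : IsFCF ψ := by
  obtain ⟨μ, hμ, rfl⟩ := h
  exact ⟨μ, inferInstance, cf_eq_charFun μ⟩

lemma isCF_of_charFun {ψ : ℝ → ℂ} (μ : Measure ℝ) (h : ψ = charFun μ) (h0 : ψ 0 = 1) :
    IsCF ψ := by
  refine ⟨μ, ⟨?_⟩, by rw [h, cf_eq_charFun]⟩
  rw [h, charFun_zero] at h0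
  have h1 : μ.real univ = 1 := by exact_mod_cast h0
  rw [Measure.real] at h1
  rwa [ENNReal.toReal_eq_one_iff] at h1

lemma IsFCF.isCF {ψ : ℝ → ℂ} (h : IsFCF ψ) (h0 : ψ 0 = 1) : IsCF ψ := by
  obtain ⟨μ, hμ, h⟩ := h
  exact isCF_of_charFun μ h h0

lemma IsFCF.add {ψ χ : ℝ → ℂ} (h : IsFCF ψ) (h' : IsFCF χ) : IsFCF (fun t => ψ t + χ t) := by
  obtain ⟨μ, hμ, rfl⟩ := h
  obtain ⟨ν, hν, rfl⟩ := h'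
  refine ⟨μ + ν, inferInstance, ?_⟩
  funext t
  simp only [charFun_eq_integral_innerProbChar]
  rw [integral_add_measure]
  · exact BoundedContinuousFunction.integrable μ _
  · exact BoundedContinuousFunction.integrable ν _

lemma IsFCF.smul {ψ : ℝ → ℂ} (h : IsFCF ψ) {a : ℝ} (ha : 0 ≤ a) :
    IsFCF (fun t => (a : ℂ) * ψ t) := by
  obtain ⟨μ, hμ, rfl⟩ := h
  refine ⟨(ENNReal.ofReal a) • μ, Measure.smul_finite _ ENNReal.ofReal_ne_top, ?_⟩
  funext t
  simp only [charFun_apply]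
  rw [integral_smul_measure, ENNReal.toReal_ofReal ha]
  simp

lemma isFCF_zero : IsFCF (fun _ => 0) := ⟨0, inferInstance, by funext t; simp⟩

lemma isFCF_one : IsFCF (fun _ => 1) :=
  ⟨Measure.dirac 0, inferInstance, by funext t; simp [charFun_dirac]⟩

lemma isFCF_sum (N : ℕ) (ψ : ℕ → ℝ → ℂ) (h : ∀ k, IsFCF (ψ k)) :
    IsFCF (fun t => ∑ k ∈ Finset.range N, ψ k t) := by
  induction N with
  | zero => simpa using isFCF_zero
  | succ n ih => simpa [Finset.sum_range_succ] using ih.add (h n)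

lemma IsFCF.scale {ψ : ℝ → ℂ} (h : IsFCF ψ) (a : ℝ) : IsFCF (fun t => ψ (a * t)) := by
  obtain ⟨μ, hμ, rfl⟩ := h
  refine ⟨μ.map (a * ·), inferInstance, ?_⟩
  funext t
  rw [charFun_map_mul]

lemma isCF_limit (ψ : ℕ → ℝ → ℂ) (χ : ℝ → ℂ) (h : ∀ n, IsCF (ψ n)) (hc : ContinuousAt χ 0)
    (hl : ∀ t, Tendsto (fun n => ψ n t) atTop (𝓝 (χ t))) : IsCF χ := by
  choose μ hμ hψ using h
  simp only [hψ, cf_eq_charFun] at hl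
  let P : ℕ → ProbabilityMeasure ℝ := fun n => ⟨μ n, hμ n⟩
  have ht := isTightMeasureSet_of_tendsto_charFun hc hl
  have h_compact : IsCompact (closure (range P)) :=
    isCompact_closure_of_isTightMeasureSet (by
      convert ht using 1
      ext x
      constructor
      · rintro ⟨_, ⟨n, rfl⟩, rfl⟩
        exact ⟨n, rfl⟩
      · rintro ⟨n, rfl⟩
        exact ⟨P n, ⟨n, rfl⟩, rfl⟩)
  let U : Ultrafilter ℕ := Ultrafilter.of atTop
  have hU : (U : Filter ℕ) ≤ atTop := Ultrafilter.of_le _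
  obtain ⟨ν, -, hν⟩ := h_compact.ultrafilter_le_nhds (U.map P) (by
    refine le_trans ?_ (monotone_principal subset_closure)
    simp)
  have hν : Tendsto P U (𝓝 ν) := hν
  refine ⟨ν, inferInstance, ?_⟩
  rw [cf_eq_charFun]
  funext t
  refine tendsto_nhds_unique ((hl t).mono_left hU) ?_
  rw [ProbabilityMeasure.tendsto_iff_forall_integral_rclike_tendsto ℂ] at hν
  simp_rw [charFun_eq_integral_innerProbChar]
  exact hν (BoundedContinuousFunction.innerProbChar t)

/-! combinatorial part -/

def pF (c : ℕ → ℝ) (N : ℕ) (x : ℝ) : ℝ :=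
  (∑ k ∈ Finset.range N, (c k - 2 * c (k+1) + c (k+2)) * max (k + 1 - |x|) 0)
    + (c N - c (N+1)) * max (N + 1 - |x|) 0 + c (N+1)

lemma pF_node (c : ℕ → ℝ) (N j : ℕ) (hj : j ≤ N + 1) : pF c N j = c j := by
  induction N with
  | zero =>
    rcases Nat.le_one_iff_eq_zero_or_eq_one.1 hj with rfl | rfl <;> simp [pF]
  | succ n ih =>
    rcases Nat.lt_or_ge (n+1) j with h | h
    · have : j = n + 2 := by omega
      subst this
      unfold pF
      rw [Finset.sum_eq_zero]
      · rw [max_eq_right]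
        · simp
        · push_cast; rw [abs_of_nonneg (by positivity)]; linarith
      · intro k hk
        have hk : (k:ℝ) + 1 ≤ n + 1 + 1 := by
          have := Finset.mem_range.1 hk
          exact_mod_cast (by omega : k + 1 ≤ n + 1 + 1)
        rw [max_eq_right]
        · simp
        · push_cast; rw [abs_of_nonneg (by positivity)]; linarith
    · rw [← ih h]
      have h : (j:ℝ) ≤ n + 1 := by exact_mod_cast h
      unfold pF
      rw [Finset.sum_range_succ, max_eq_left (a := (n:ℝ) + 1 - |(j:ℝ)|),
        max_eq_left (a := ((n+1 : ℕ):ℝ) + 1 - |(j:ℝ)|)]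
      · push_cast; ring
      · push_cast; rw [abs_of_nonneg (by positivity)]; linarith
      · rw [abs_of_nonneg (by positivity)]; linarith

lemma pF_anti (c : ℕ → ℝ) (N : ℕ) (hd : ∀ k, 0 ≤ c k - 2 * c (k+1) + c (k+2))
    (ha : ∀ k, c (k+1) ≤ c k) {x y : ℝ} (h : |x| ≤ |y|) : pF c N y ≤ pF c N x := by
  unfold pF
  gcongr
  · exact hd _
  · linarith [ha N]

lemma isCF_pF (htri : IsFCF fun t : ℝ => ((max (1 - |t|) 0 : ℝ) : ℂ)) (c : ℕ → ℝ) (N : ℕ)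
    (hd : ∀ k, 0 ≤ c k - 2 * c (k+1) + c (k+2))
    (ha : ∀ k, c (k+1) ≤ c k) (h0 : c 0 = 1) (hc : 0 ≤ c (N+1)) (a : ℝ) :
    IsCF (fun t => ((pF c N (a * t) : ℝ) : ℂ)) := by
  have key : ∀ k : ℕ, IsFCF (fun t : ℝ => ((max (k + 1 - |t|) 0 : ℝ) : ℂ)) := by
    intro k
    have := (htri.scale ((k+1 : ℝ)⁻¹)).smul (a := k+1) (by positivity)
    convert this using 2 with t
    rw [← Complex.ofReal_mul, mul_max_of_nonneg _ _ (by positivity), abs_mul,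
      abs_of_nonneg (by positivity : 0 ≤ ((k:ℝ)+1)⁻¹)]
    congr 2
    · field_simp
    · simp
  have h1 : IsFCF (fun t => ((pF c N t : ℝ) : ℂ)) := by
    have := ((isFCF_sum N _ (fun k => (key k).smul (hd k))).add
      ((key N).smul (sub_nonneg.2 (ha N)))).add (isFCF_one.smul hc)
    convert this using 2 with t
    simp [pF]
  refine (h1.scale a).isCF ?_
  have := pF_node c N 0 (by omega)
  rw [Nat.cast_zero] at this
  simp [this, h0]

lemma polya (htri : IsFCF fun t : ℝ => ((max (1 - |t|) 0 : ℝ) : ℂ)) (φ : ℝ → ℝ)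
    (heven : ∀ t, φ (-t) = φ t) (hcont : Continuous φ)
    (hconv : ConvexOn ℝ (Ici (0:ℝ)) φ) (h0 : φ 0 = 1) (h01 : ∀ t, φ t ∈ Icc (0:ℝ) 1)
    (hlim : Tendsto φ atTop (𝓝 0)) : IsCF fun t => ((φ t : ℝ) : ℂ) := by
  let c : ℕ → ℕ → ℝ := fun n k => φ (k / ((n + 1 : ℕ) : ℝ))
  have hd : ∀ n k, 0 ≤ c n k - 2 * c n (k+1) + c n (k+2) := by
    intro n k
    have hx : (k / ((n + 1 : ℕ) : ℝ)) ∈ Ici (0:ℝ) := by simp only [mem_Ici]; positivity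
    have hy : ((k + 2 : ℕ) : ℝ) / ((n + 1 : ℕ) : ℝ) ∈ Ici (0:ℝ) := by
      simp only [mem_Ici]; positivity
    have := hconv.2 hx hy (by norm_num : (0:ℝ) ≤ 1/2) (by norm_num : (0:ℝ) ≤ 1/2) (by norm_num)
    have e : (1/2:ℝ) • (k / ((n + 1 : ℕ) : ℝ)) + (1/2:ℝ) • (((k + 2 : ℕ) : ℝ) / ((n + 1 : ℕ) : ℝ))
      = ((k+1 : ℕ):ℝ) / ((n + 1 : ℕ) : ℝ) := by
      simp only [smul_eq_mul]; push_cast; ring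
    rw [e] at this
    simp only [smul_eq_mul] at this
    simp only [c]
    linarith
  have hcl : ∀ n, Tendsto (c n) atTop (𝓝 0) := by
    intro n
    exact hlim.comp (tendsto_natCast_atTop_atTop.atTop_div_const (by positivity))
  have ha : ∀ n k, c n (k+1) ≤ c n k := by
    intro n k
    have hanti : Antitone (fun k => c n k - c n (k+1)) :=
      antitone_nat_of_succ_le (fun k => by linarith [hd n k])
    have hl : Tendsto (fun k => c n k - c n (k+1)) atTop (𝓝 0) := by
      simpa using (hcl n).sub ((tendsto_add_atTop_iff_nat 1).2 (hcl n))
    linarith [hanti.le_of_tendsto hl k]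
  refine isCF_limit (fun n t => ((pF (c n) ((n+1)^2) (((n+1 : ℕ):ℝ) * t) : ℝ) : ℂ)) _
    (fun n => isCF_pF htri _ _ (hd n) (ha n) (by simp [c, h0]) (h01 _).1 _) (by fun_prop) ?_
  intro t
  refine (Complex.continuous_ofReal.tendsto _).comp ?_
  have habs : φ t = φ |t| := by
    rcases abs_choice t with h | h <;> rw [h]
    rw [heven]
  rw [habs]
  have hN : Tendsto (fun n : ℕ => ((n+1 : ℕ) : ℝ)) atTop atTop :=
    tendsto_natCast_atTop_atTop.comp (tendsto_add_atTop_nat 1)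
  have hf : Tendsto (fun n : ℕ => (⌊|t| * ((n+1 : ℕ) : ℝ)⌋₊ : ℝ) / ((n+1 : ℕ) : ℝ)) atTop (𝓝 |t|) :=
    (tendsto_nat_floor_mul_div_atTop (abs_nonneg t)).comp hN
  have hf' : Tendsto (fun n : ℕ => ((⌊|t| * ((n+1 : ℕ) : ℝ)⌋₊ + 1 : ℕ) : ℝ) / ((n+1 : ℕ) : ℝ))
      atTop (𝓝 |t|) := by
    have := hf.add (tendsto_inv_atTop_zero.comp hN)
    rw [add_zero] at this
    refine this.congr fun n => ?_
    simp only [Function.comp]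
    push_cast
    rw [add_div, one_div]
  have hev : ∀ᶠ n : ℕ in atTop, ⌊|t| * ((n+1 : ℕ) : ℝ)⌋₊ ≤ (n+1)^2 := by
    filter_upwards [hN.eventually_ge_atTop |t|] with n hn
    apply Nat.floor_le_of_le
    push_cast at hn ⊢
    nlinarith [abs_nonneg t]
  refine tendsto_of_tendsto_of_tendsto_of_le_of_le' ((hcont.tendsto _).comp hf')
    ((hcont.tendsto _).comp hf) ?_ ?_
  · filter_upwards [hev] with n hn
    have := pF_node (c n) ((n+1)^2) (⌊|t| * ((n+1 : ℕ) : ℝ)⌋₊ + 1) (by omega)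
    simp only [Function.comp]
    change c n _ ≤ _
    rw [← this]
    apply pF_anti _ _ (hd n) (ha n)
    rw [abs_mul, Nat.abs_cast, Nat.abs_cast, mul_comm, Nat.cast_succ (⌊_⌋₊)]
    exact (Nat.lt_floor_add_one _).le
  · filter_upwards [hev] with n hn
    have := pF_node (c n) ((n+1)^2) (⌊|t| * ((n+1 : ℕ) : ℝ)⌋₊) (by omega)
    simp only [Function.comp]
    change _ ≤ c n _
    rw [← this]
    apply pF_anti _ _ (hd n) (ha n)
    rw [abs_mul, Nat.abs_cast, Nat.abs_cast, mul_comm _ |t|]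
    exact Nat.floor_le (by positivity)

/-! the triangle -/

noncomputable def tri (t : ℝ) : ℂ := ((max (1 - |t|) 0 : ℝ) : ℂ)

lemma tri_cont : Continuous tri := by unfold tri; fun_prop

lemma tri_zero {t : ℝ} (h : t ∉ Ioc (-1:ℝ) 1) : tri t = 0 := by
  unfold tri
  rw [max_eq_right]
  · simp
  · by_contra! hh
    have : |t| < 1 := by linarith
    rw [abs_lt] at this
    exact h ⟨this.1, this.2.le⟩

lemma tri_int : Integrable tri := by
  refine tri_cont.integrable_of_hasCompactSupport ?_
  refine HasCompactSupport.intro (K := Icc (-1) 1) isCompact_Icc fun x hx => ?_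
  exact tri_zero (fun h => hx ⟨h.1.le, h.2⟩)

lemma int_half (c : ℂ) (hc : c ≠ 0) :
    ∫ t in (0:ℝ)..1, Complex.exp (c * t) * (1 - t) = Complex.exp c / c^2 - 1 / c - 1 / c^2 := by
  have := intervalIntegral.integral_eq_sub_of_hasDerivAt (a := 0) (b := 1)
    (f := fun t : ℝ => (1 - t) * Complex.exp (c * t) / c + Complex.exp (c * t) / c^2)
    (f' := fun t : ℝ => Complex.exp (c * t) * (1 - t)) ?_ ?_
  · rw [this]; simp; ring
  · intro t _
    have h1 : HasDerivAt (fun t : ℝ => (t:ℂ)) 1 t := Complex.ofRealCLM.hasDerivAt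
    have h2 : HasDerivAt (fun t : ℝ => Complex.exp (c * t)) (Complex.exp (c * t) * (c * 1)) t :=
      (h1.const_mul c).cexp
    have h3 := (((h1.const_sub 1).mul h2).div_const c).add (h2.div_const (c^2))
    refine h3.congr_deriv ?_
    field_simp
    ring
  · apply Continuous.intervalIntegrable
    fun_prop

lemma int_tri (c : ℂ) (hc : c ≠ 0) :
    ∫ t : ℝ, Complex.exp (c * t) * tri t = (Complex.exp c + Complex.exp (-c) - 2) / c^2 := by
  have hcont : Continuous fun t : ℝ => Complex.exp (c * t) * tri t := by
    have := tri_cont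
    fun_prop
  have h1 : ∫ t : ℝ, Complex.exp (c * t) * tri t
      = ∫ t in (-1:ℝ)..1, Complex.exp (c * t) * tri t := by
    rw [intervalIntegral.integral_of_le (by norm_num), setIntegral_eq_integral_of_forall_compl_eq_zero]
    intro x hx
    rw [tri_zero hx, mul_zero]
  have hpos : ∀ c : ℂ, c ≠ 0 → ∫ t in (0:ℝ)..1, Complex.exp (c * t) * tri t
      = Complex.exp c / c^2 - 1 / c - 1 / c^2 := by
    intro c hc
    rw [← int_half c hc]
    apply intervalIntegral.integral_congr
    intro t ht
    rw [uIcc_of_le (by norm_num)] at ht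
    simp only [tri]
    rw [abs_of_nonneg ht.1, max_eq_left (by linarith [ht.2])]
    push_cast; rfl
  have hneg : ∫ t in (-1:ℝ)..0, Complex.exp (c * t) * tri t
      = ∫ t in (0:ℝ)..1, Complex.exp ((-c) * t) * tri t := by
    have := intervalIntegral.integral_comp_neg (a := 0) (b := 1)
      (fun t : ℝ => Complex.exp (c * t) * tri t)
    rw [neg_zero] at this
    rw [← this]
    simp [tri]
  rw [h1, ← intervalIntegral.integral_add_adjacent_intervals (b := 0)
    (hcont.intervalIntegrable _ _) (hcont.intervalIntegrable _ _), hneg, hpos _ hc,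
    hpos _ (neg_ne_zero.2 hc)]
  field_simp
  ring

noncomputable def gk (w : ℝ) : ℝ := (1 - Real.cos (2 * Real.pi * w)) / (2 * Real.pi^2 * w^2)

lemma gk_nonneg (w : ℝ) : 0 ≤ gk w := by
  unfold gk
  have := Real.cos_le_one (2 * Real.pi * w)
  apply div_nonneg (by linarith) (by positivity)

lemma fourier_tri (w : ℝ) (hw : w ≠ 0) : 𝓕 tri w = (gk w : ℂ) := by
  rw [Real.fourier_real_eq_integral_exp_smul]
  have hpi : (Real.pi : ℂ) ≠ 0 := by exact_mod_cast Real.pi_ne_zero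
  have hw' : (w : ℂ) ≠ 0 := by exact_mod_cast hw
  have := int_tri (-(2 * Real.pi * w * Complex.I)) (by simp [hw, Real.pi_ne_zero])
  rw [neg_neg, add_comm (Complex.exp _)] at this
  have e : (Complex.exp (2 * Real.pi * w * Complex.I) + Complex.exp (-(2 * Real.pi * w * Complex.I)))
    = 2 * Complex.cos (2 * Real.pi * w) := by
    rw [Complex.cos]; ring_nf
  rw [e] at this
  calc _ = ∫ t : ℝ, Complex.exp (-(2 * Real.pi * w * Complex.I) * t) * tri t := by
        congr 1; funext t; rw [smul_eq_mul]; push_cast; congr 2; ring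
    _ = _ := by
        rw [this]
        unfold gk
        push_cast
        rw [neg_sq, mul_pow _ Complex.I, Complex.I_sq]
        field_simp
        ring

lemma fourier_tri_int : Integrable (𝓕 tri) := by
  have hc : Continuous (𝓕 tri) :=
    VectorFourier.fourierIntegral_continuous Real.continuous_fourierChar
      (by exact continuous_inner) tri_int
  refine (integrable_inv_one_add_sq.const_mul ((∫ v, ‖tri v‖) + 1)).mono' hc.aestronglyMeasurable ?_
  have hne : ∀ᵐ w : ℝ, w ≠ 0 := by simp [ae_iff]
  filter_upwards [hne] with w hw
  have h1 : ‖𝓕 tri w‖ ≤ ∫ v, ‖tri v‖ :=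
    VectorFourier.norm_fourierIntegral_le_integral_norm _ _ _ _ _
  have h2 : ‖𝓕 tri w‖ * w^2 ≤ 1 := by
    rw [fourier_tri w hw, Complex.norm_real, Real.norm_of_nonneg (gk_nonneg w), gk]
    have hp := Real.pi_gt_three
    have := Real.neg_one_le_cos (2 * Real.pi * w)
    have hw2 : 0 < w^2 := by positivity
    rw [div_mul_eq_mul_div, div_le_one (by positivity)]
    have : 1 - Real.cos (2 * Real.pi * w) ≤ 2 * Real.pi^2 := by nlinarith
    nlinarith
  rw [← div_eq_mul_inv, le_div_iff₀ (by positivity)]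
  linarith

lemma tri_isFCF : IsCF tri := by
  let μ : Measure ℝ := volume.withDensity (fun w => ENNReal.ofReal (gk w))
  have hm : Measurable gk := by unfold gk; fun_prop
  have hne : ∀ᵐ w : ℝ, w ≠ 0 := by simp [ae_iff]
  have key : ∀ t, charFun μ (2 * Real.pi * t) = tri t := by
    intro t
    rw [← congrFun (tri_cont.fourierInv_fourier_eq tri_int fourier_tri_int) t,
      Real.fourierInv_eq', charFun_apply_real,
      integral_withDensity_eq_integral_toReal_smul (by fun_prop) (by simp)]
    apply integral_congr_ae
    filter_upwards [hne] with w hw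
    rw [fourier_tri w hw, ENNReal.toReal_ofReal (gk_nonneg w), smul_eq_mul, mul_comm,
      Complex.real_smul, mul_comm]
    congr 2
    simp
    ring
  refine isCF_of_charFun (μ.map ((2 * Real.pi) * ·)) ?_ (by simp [tri])
  funext t
  rw [charFun_map_mul, key]

theorem stmt7 :
    (∀ φ : ℝ → ℝ, (∀ t, φ (-t) = φ t) → Continuous φ →
      ConvexOn ℝ (Ici (0:ℝ)) φ → φ 0 = 1 → (∀ t, φ t ∈ Icc (0:ℝ) 1) →
      Filter.Tendsto φ Filter.atTop (nhds 0) →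
      IsCF fun t => ((φ t : ℝ) : ℂ)) ∧
    IsCF fun t : ℝ => ((max (1 - |t|) 0 : ℝ) : ℂ) :=
  ⟨fun φ h1 h2 h3 h4 h5 h6 => polya (IsCF.isFCF tri_isFCF) φ h1 h2 h3 h4 h5 h6, tri_isFCF⟩
end

section
/- For 0 < α ≤ 1 and 0 < λ ≤ 1, the function φ(t) = 1 - λ|t|^α for |t| ≤ λ^{-1/α} and φ(t) = 0 for |t| > λ^{-1/α} is a characteristic function; it arises as P(φ_1(t)) where P(s) = 1 - λ(1-s)^α is the Sibuya(α,λ) PGF and φ_1(t) = max(1-|t|,0) is the triangular(1) characteristic function. -/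
open MeasureTheory Set

noncomputable def triF (v : ℝ) : ℝ := max (1 - |v|) 0

theorem triF_cont : Continuous triF := by unfold triF; fun_prop

theorem triF_supp : Function.support triF ⊆ Ioc (-1) 1 := by
  intro v hv
  by_contra h
  apply hv
  unfold triF
  apply max_eq_right
  by_contra h2
  have h3 : |v| < 1 := by linarith
  rw [abs_lt] at h3
  exact h ⟨h3.1, h3.2.le⟩

theorem triF_ft (c : ℝ) (hc : c ≠ 0) :
    ∫ v : ℝ, Complex.exp ((c * v : ℝ) * Complex.I) * (triF v : ℂ)
      = (((2 - 2 * Real.cos c) / c ^ 2 : ℝ) : ℂ) := by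
  have hs : Function.support (fun v : ℝ => Complex.exp ((c * v : ℝ) * Complex.I) * (triF v : ℂ))
      ⊆ Ioc (-1) 1 := by
    refine subset_trans ?_ triF_supp
    intro v hv hv'
    apply hv
    simp only [hv', Complex.ofReal_zero, mul_zero]
  have hcont : Continuous (fun v : ℝ => Complex.exp ((c * v : ℝ) * Complex.I) * (triF v : ℂ)) := by
    have := triF_cont
    fun_prop
  rw [← intervalIntegral.integral_eq_integral_of_support_subset hs,
    ← intervalIntegral.integral_add_adjacent_intervals (hcont.intervalIntegrable (-1) 0)
      (hcont.intervalIntegrable 0 1)]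
  have hc' : (c : ℂ) ≠ 0 := by exact_mod_cast hc
  have hcC : (c : ℂ) * Complex.I ≠ 0 := by simp [hc]
  have hE : ∀ v : ℝ, HasDerivAt (fun v : ℝ => Complex.exp ((c * v : ℝ) * Complex.I))
      (Complex.exp ((c * v : ℝ) * Complex.I) * (c * Complex.I)) v := by
    intro v
    have h1 : HasDerivAt (fun v : ℝ => ((c * v : ℝ) : ℂ) * Complex.I) (c * Complex.I) v := by
      have := (((hasDerivAt_id v).const_mul c).ofReal_comp).mul_const Complex.I
      simpa using this
    exact h1.cexp
  have hid : ∀ v : ℝ, HasDerivAt (fun v : ℝ => (v : ℂ)) 1 v := fun v =>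
    by simpa using (hasDerivAt_id v).ofReal_comp
  have e1 : ∫ v in (0:ℝ)..1, Complex.exp ((c * v : ℝ) * Complex.I) * (triF v : ℂ)
      = Complex.exp (c * Complex.I) / (c * Complex.I) ^ 2
        - (1 / (c * Complex.I) + 1 / (c * Complex.I) ^ 2) := by
    have : ∫ v in (0:ℝ)..1, Complex.exp ((c * v : ℝ) * Complex.I) * (triF v : ℂ)
        = ∫ v in (0:ℝ)..1, Complex.exp ((c * v : ℝ) * Complex.I) * (1 - v : ℂ) := by
      apply intervalIntegral.integral_congr
      intro v hv
      rw [uIcc_of_le zero_le_one] at hv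
      simp only [triF, abs_of_nonneg hv.1, max_eq_left (sub_nonneg.2 hv.2)]
      push_cast; rfl
    rw [this, intervalIntegral.integral_eq_sub_of_hasDerivAt
      (f := fun v : ℝ => Complex.exp ((c * v : ℝ) * Complex.I) * (1 - v : ℂ) / (c * Complex.I)
        + Complex.exp ((c * v : ℝ) * Complex.I) / (c * Complex.I) ^ 2)]
    · simp
    · intro v _
      have := (((hE v).mul ((hid v).const_sub 1)).div_const (c * Complex.I)).add
        ((hE v).div_const ((c * Complex.I) ^ 2))
      refine this.congr_deriv ?_
      field_simp
      ring
    · apply Continuous.intervalIntegrable; fun_prop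
  have e2 : ∫ v in (-1:ℝ)..0, Complex.exp ((c * v : ℝ) * Complex.I) * (triF v : ℂ)
      = (1 / (c * Complex.I) - 1 / (c * Complex.I) ^ 2)
        + Complex.exp (-(c * Complex.I)) / (c * Complex.I) ^ 2 := by
    have : ∫ v in (-1:ℝ)..0, Complex.exp ((c * v : ℝ) * Complex.I) * (triF v : ℂ)
        = ∫ v in (-1:ℝ)..0, Complex.exp ((c * v : ℝ) * Complex.I) * (1 + v : ℂ) := by
      apply intervalIntegral.integral_congr
      intro v hv
      rw [uIcc_of_le (by norm_num)] at hv
      have h0 : 0 ≤ 1 - -v := by linarith [hv.1]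
      simp only [triF, abs_of_nonpos hv.2, max_eq_left h0]
      push_cast; ring
    rw [this, intervalIntegral.integral_eq_sub_of_hasDerivAt
      (f := fun v : ℝ => Complex.exp ((c * v : ℝ) * Complex.I) * (1 + v : ℂ) / (c * Complex.I)
        - Complex.exp ((c * v : ℝ) * Complex.I) / (c * Complex.I) ^ 2)]
    · simp
    · intro v _
      have := (((hE v).mul ((hid v).const_add 1)).div_const (c * Complex.I)).sub
        ((hE v).div_const ((c * Complex.I) ^ 2))
      refine this.congr_deriv ?_
      field_simp
      ring
    · apply Continuous.intervalIntegrable; fun_prop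
  rw [e1, e2]
  have hcos : ((Real.cos c : ℝ) : ℂ)
      = (Complex.exp (c * Complex.I) + Complex.exp (-(c * Complex.I))) / 2 := by
    rw [Complex.ofReal_cos, Complex.cos, neg_mul]
  push_cast [hcos]
  rw [show ((c : ℂ) * Complex.I) ^ 2 = - (c:ℂ)^2 by rw [mul_pow, Complex.I_sq]; ring]
  field_simp
  ring

noncomputable def fej (w : ℝ) : ℝ :=
  (2 - 2 * Real.cos (2 * Real.pi * w)) / (2 * Real.pi * w) ^ 2

theorem fej_nonneg (w : ℝ) : 0 ≤ fej w :=
  div_nonneg (by linarith [Real.cos_le_one (2 * Real.pi * w)]) (sq_nonneg _)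

theorem fej_meas : Measurable fej := by unfold fej; fun_prop

theorem fej_int : Integrable fej := by
  refine Integrable.mono' (integrable_inv_one_add_sq.const_mul 5) fej_meas.aestronglyMeasurable ?_
  refine Filter.Eventually.of_forall fun w => ?_
  rw [Real.norm_of_nonneg (fej_nonneg w)]
  unfold fej
  by_cases hw : w = 0
  · subst hw; simp
  have hc := Real.one_sub_sq_div_two_le_cos (x := 2 * Real.pi * w)
  have hc2 := Real.neg_one_le_cos (2 * Real.pi * w)
  have hcw : w ^ 2 ≤ (2 * Real.pi * w) ^ 2 := by
    rw [mul_pow]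
    have : 1 ≤ (2 * Real.pi) ^ 2 := by nlinarith [Real.pi_gt_three]
    nlinarith [sq_nonneg w]
  have hw2 : 0 < w ^ 2 := by positivity
  generalize Real.cos (2 * Real.pi * w) = k at *
  generalize 2 * Real.pi * w = c at *
  rw [← div_eq_mul_inv, div_le_div_iff₀ (by linarith) (by positivity)]
  nlinarith

open FourierTransform in
theorem fej_cf (t : ℝ) :
    ∫ x : ℝ, Complex.exp ((t * x : ℝ) * Complex.I) * (fej x : ℂ) = triF (t / (2 * Real.pi)) := by
  have hft : 𝓕 (fun v => (triF v : ℂ)) =ᵐ[volume] fun w => (fej w : ℂ) := by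
    have : ∀ᵐ w : ℝ, w ≠ 0 := by simp [ae_iff]
    filter_upwards [this] with w hw
    rw [Real.fourier_real_eq_integral_exp_smul]
    have h := triF_ft (-(2 * Real.pi * w)) (by simp [hw, Real.pi_ne_zero])
    rw [Real.cos_neg, neg_sq] at h
    rw [fej, ← h]
    congr 1; ext v
    rw [smul_eq_mul]
    congr 4; ring
  have hc : Continuous (fun v => (triF v : ℂ)) := by
    have := triF_cont
    fun_prop
  have hcs : HasCompactSupport (fun v => (triF v : ℂ)) := by
    refine HasCompactSupport.intro (isCompact_Icc (a := (-1:ℝ)) (b := 1)) fun x hx => ?_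
    have : triF x = 0 := by
      by_contra h
      exact hx (Ioc_subset_Icc_self (triF_supp h))
    simp [this]
  have hinv := hc.fourierInv_fourier_eq (hc.integrable_of_hasCompactSupport hcs)
    (fej_int.ofReal.congr hft.symm)
  have := congrFun hinv (t / (2 * Real.pi))
  rw [← this, Real.fourierInv_eq']
  apply integral_congr_ae
  filter_upwards [hft] with x hx
  rw [hx, smul_eq_mul]
  congr 4
  have := Real.pi_ne_zero
  simp
  field_simp

noncomputable def fejM : Measure ℝ := volume.withDensity fun w => ENNReal.ofReal (fej w)

theorem fejM_cf (t : ℝ) :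
    ∫ x : ℝ, Complex.exp ((t * x : ℝ) * Complex.I) ∂fejM = triF (t / (2 * Real.pi)) := by
  rw [← fej_cf, fejM, integral_withDensity_eq_integral_toReal_smul fej_meas.ennreal_ofReal (by simp)]
  congr 1; ext x
  rw [ENNReal.toReal_ofReal (fej_nonneg x), Complex.real_smul, mul_comm]

instance fejM_prob : IsProbabilityMeasure fejM := by
  constructor
  rw [fejM, withDensity_apply _ MeasurableSet.univ, Measure.restrict_univ,
    ← ofReal_integral_eq_lintegral_ofReal fej_int (Filter.Eventually.of_forall fej_nonneg)]
  have h := fej_cf 0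
  simp [triF, integral_complex_ofReal] at h
  have h' : ∫ x, fej x = 1 := by exact_mod_cast h
  simp [h']

noncomputable def mixD (α r : ℝ) : ℝ := α * (1 - α) * r ^ (α - 1)

noncomputable def mixM (α : ℝ) : Measure ℝ :=
  (volume.restrict (Ioc 0 1)).withDensity (fun r => ENNReal.ofReal (mixD α r))
    + ENNReal.ofReal α • Measure.dirac 1

theorem mixD_meas (α : ℝ) : Measurable (mixD α) := by unfold mixD; fun_prop

theorem mixD_nonneg {α : ℝ} (h0 : 0 < α) (h1 : α ≤ 1) {r : ℝ} (hr : r ∈ Ioc (0:ℝ) 1) :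
    0 ≤ mixD α r := by
  have := Real.rpow_nonneg hr.1.le (α - 1)
  have : 0 ≤ 1 - α := by linarith
  unfold mixD
  positivity

theorem mixD_int {α : ℝ} (h0 : 0 < α) : Integrable (mixD α) (volume.restrict (Ioc 0 1)) := by
  have := (intervalIntegral.intervalIntegrable_rpow' (a := 0) (b := 1) (r := α - 1)
    (by linarith)).const_mul (α * (1 - α))
  rwa [intervalIntegrable_iff_integrableOn_Ioc_of_le zero_le_one] at this

theorem mixM_prob {α : ℝ} (h0 : 0 < α) (h1 : α ≤ 1) : IsProbabilityMeasure (mixM α) := by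
  constructor
  have hnn : 0 ≤ᵐ[volume.restrict (Ioc 0 1)] mixD α := by
    filter_upwards [ae_restrict_mem measurableSet_Ioc] with r hr
    exact mixD_nonneg h0 h1 hr
  have e : ∫ r in Ioc 0 1, mixD α r = 1 - α := by
    rw [← intervalIntegral.integral_of_le zero_le_one]
    unfold mixD
    rw [intervalIntegral.integral_const_mul, integral_rpow (Or.inl (by linarith))]
    simp [Real.zero_rpow h0.ne']
    field_simp
  rw [mixM, Measure.add_apply, withDensity_apply _ MeasurableSet.univ, Measure.restrict_univ,
    ← ofReal_integral_eq_lintegral_ofReal (mixD_int h0) hnn, e]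
  simp
  rw [← ENNReal.ofReal_add (by linarith) h0.le]
  simp

theorem triF_meas2 (s : ℝ) : Measurable fun r => triF (s / r) :=
  triF_cont.measurable.comp (by fun_prop)

theorem triF_bd (s : ℝ) : ‖triF s‖ ≤ 1 := by
  unfold triF
  rw [Real.norm_of_nonneg (le_max_right _ _)]
  exact max_le (by linarith [abs_nonneg s]) zero_le_one

theorem mix_cf {α : ℝ} (h0 : 0 < α) (h1 : α ≤ 1) (s : ℝ) :
    ∫ r, triF (s / r) ∂(mixM α) = max (1 - |s| ^ α) 0 := by
  have := mixM_prob h0 h1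
  by_cases hs : s = 0
  · subst hs; simp [triF, Real.zero_rpow h0.ne']
  have hu : 0 < |s| := abs_pos.2 hs
  have hint : Integrable (fun r => triF (s / r)) (mixM α) :=
    Integrable.of_bound (triF_meas2 s).aestronglyMeasurable 1
      (Filter.Eventually.of_forall fun r => triF_bd _)
  have hint' := hint
  rw [mixM, integrable_add_measure] at hint'
  rw [mixM, integral_add_measure hint'.1 hint'.2, integral_smul_measure, integral_dirac,
    integral_withDensity_eq_integral_toReal_smul (mixD_meas α).ennreal_ofReal (by simp)]
  have e1 : ∫ r in Ioc (0:ℝ) 1, (ENNReal.ofReal (mixD α r)).toReal • triF (s / r)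
      = ∫ r in Ioc (0:ℝ) 1, mixD α r * triF (s / r) := by
    apply setIntegral_congr_fun measurableSet_Ioc
    intro r hr
    simp only [ENNReal.toReal_ofReal (mixD_nonneg h0 h1 hr), smul_eq_mul]
  have hz : ∀ r, 0 < r → r ≤ |s| → triF (s / r) = 0 := by
    intro r hr hrs
    unfold triF
    apply max_eq_right
    rw [abs_div, abs_of_pos hr]
    have := (one_le_div hr).2 hrs
    linarith
  rw [e1, ENNReal.toReal_ofReal h0.le]
  rcases le_or_gt 1 |s| with h | h
  · have : ∫ r in Ioc (0:ℝ) 1, mixD α r * triF (s / r) = 0 := by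
      apply setIntegral_eq_zero_of_forall_eq_zero
      intro r hr
      rw [hz r hr.1 (hr.2.trans h), mul_zero]
    rw [this, hz 1 one_pos h, max_eq_right]
    · simp
    · linarith [Real.one_le_rpow h h0.le]
  · have e2 : ∫ r in Ioc (0:ℝ) 1, mixD α r * triF (s / r)
        = ∫ r in |s|..1, mixD α r * (1 - |s| / r) := by
      rw [intervalIntegral.integral_of_le h.le]
      rw [setIntegral_eq_of_subset_of_forall_sdiff_eq_zero measurableSet_Ioc
        (Ioc_subset_Ioc_left hu.le : Ioc |s| 1 ⊆ Ioc 0 1)]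
      · apply setIntegral_congr_fun measurableSet_Ioc
        intro r hr
        have hr0 : 0 < r := hu.trans hr.1
        simp only [triF, abs_div, abs_of_pos hr0]
        rw [max_eq_left]
        have := (div_le_one hr0).2 hr.1.le
        linarith
      · intro r hr
        rw [hz r hr.1.1, mul_zero]
        by_contra hh
        exact hr.2 ⟨not_le.1 hh, hr.1.2⟩
    have e3 : ∫ r in |s|..1, mixD α r * (1 - |s| / r)
        = ((1 - α) * (1:ℝ) ^ α + |s| * α * (1:ℝ) ^ (α - 1))
          - ((1 - α) * |s| ^ α + |s| * α * |s| ^ (α - 1)) := by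
      rw [intervalIntegral.integral_eq_sub_of_hasDerivAt
        (f := fun r : ℝ => (1 - α) * r ^ α + |s| * α * r ^ (α - 1))]
      · intro r hr
        rw [uIcc_of_le h.le] at hr
        have hr0 : 0 < r := hu.trans_le hr.1
        have := ((Real.hasDerivAt_rpow_const (p := α) (Or.inl hr0.ne')).const_mul (1 - α)).add
          ((Real.hasDerivAt_rpow_const (p := α - 1) (Or.inl hr0.ne')).const_mul (|s| * α))
        refine this.congr_deriv ?_
        rw [mixD, Real.rpow_sub_one hr0.ne' (α - 1)]
        field_simp
        ring
      · apply ContinuousOn.intervalIntegrable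
        rw [uIcc_of_le h.le]
        intro r hr
        have hr0 : r ≠ 0 := (hu.trans_le hr.1).ne'
        apply ContinuousAt.continuousWithinAt
        unfold mixD
        have := Real.continuousAt_rpow_const r (α - 1) (Or.inl hr0)
        fun_prop (disch := assumption)
    rw [e2, e3, Real.one_rpow, Real.one_rpow, div_one, triF, max_eq_left (by linarith),
      max_eq_left (by linarith [Real.rpow_le_one hu.le h.le h0.le]), Real.rpow_sub_one hu.ne']
    simp only [smul_eq_mul]
    field_simp
    ring

theorem isCF_main {α lam : ℝ} (h0 : 0 < α) (h1 : α ≤ 1) (hl0 : 0 < lam) :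
    IsCF fun t => ((max (1 - lam * |t| ^ α) 0 : ℝ) : ℂ) := by
  have := mixM_prob h0 h1
  set L : ℝ := lam ^ (1 / α) with hL
  have hLp : 0 < L := Real.rpow_pos_of_pos hl0 _
  have hLα : L ^ α = lam := by
    rw [hL, ← Real.rpow_mul hl0.le, one_div_mul_cancel h0.ne', Real.rpow_one]
  have hm : Measurable fun p : ℝ × ℝ => 2 * Real.pi * L * p.2 / p.1 := by fun_prop
  refine ⟨((mixM α).prod fejM).map fun p => 2 * Real.pi * L * p.2 / p.1,
    Measure.isProbabilityMeasure_map hm.aemeasurable, ?_⟩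
  ext t
  have hc : Continuous fun x : ℝ => Complex.exp (t * x * Complex.I) := by fun_prop
  rw [cf, integral_map hm.aemeasurable hc.aestronglyMeasurable, integral_prod]
  · have : ∀ r : ℝ, ∫ y, Complex.exp (t * ((2 * Real.pi * L * y / r : ℝ) : ℂ) * Complex.I) ∂fejM
        = ((triF (t * L / r) : ℝ) : ℂ) := by
      intro r
      have h := fejM_cf (2 * Real.pi * (t * L / r))
      rw [mul_div_cancel_left₀ _ (by positivity)] at h
      rw [← h]
      congr 1; ext y; congr 2
      push_cast; ring
    simp only [this]
    rw [integral_complex_ofReal, mix_cf h0 h1, abs_mul, abs_of_pos hLp,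
      Real.mul_rpow (abs_nonneg t) hLp.le, hLα, mul_comm lam]
  · refine Integrable.of_bound (hc.measurable.comp hm).aestronglyMeasurable 1
      (Filter.Eventually.of_forall fun p => ?_)
    rw [← Complex.ofReal_mul, Complex.norm_exp_ofReal_mul_I]

/-- For `0 < α ≤ 1`, `0 < λ ≤ 1`, the function `φ(t) = 1 - λ|t|^α` for
`|t| ≤ λ^{-1/α}` and `0` beyond is a characteristic function, and for `|t| ≤ 1` it
equals `P(φ₁(t))` where `P(s) = 1-λ(1-s)^α` and `φ₁(t) = max(1-|t|,0)`. -/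
theorem stmt8 (α lam : ℝ) (hα0 : 0 < α) (hα1 : α ≤ 1) (hl0 : 0 < lam) (hl1 : lam ≤ 1) :
    let φ : ℝ → ℝ := fun t => if |t| ≤ lam ^ (-(1 / α)) then 1 - lam * |t| ^ α else 0
    (IsCF fun t => ((φ t : ℝ) : ℂ)) ∧
    ∀ t : ℝ, |t| ≤ 1 → φ t = 1 - lam * (1 - max (1 - |t|) 0) ^ α := by
  intro φ
  have hB : (lam ^ (-(1 / α))) ^ α = lam⁻¹ := by
    rw [← Real.rpow_mul hl0.le, neg_mul, one_div_mul_cancel hα0.ne', Real.rpow_neg_one]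
  have hBp : 0 < lam ^ (-(1 / α)) := Real.rpow_pos_of_pos hl0 _
  refine ⟨?_, ?_⟩
  · have : φ = fun t => max (1 - lam * |t| ^ α) 0 := by
      ext t
      simp only [φ]
      split_ifs with h
      · have h2 := Real.rpow_le_rpow (abs_nonneg t) h hα0.le
        rw [hB] at h2
        have := mul_le_mul_of_nonneg_left h2 hl0.le
        rw [mul_inv_cancel₀ hl0.ne'] at this
        rw [max_eq_left (by linarith)]
      · have h2 := Real.rpow_le_rpow hBp.le (not_le.1 h).le hα0.le
        rw [hB] at h2
        have := mul_le_mul_of_nonneg_left h2 hl0.le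
        rw [mul_inv_cancel₀ hl0.ne'] at this
        rw [max_eq_right (by linarith)]
    rw [this]
    exact isCF_main hα0 hα1 hl0
  · intro t ht
    have h1 : 1 ≤ lam ^ (-(1 / α)) :=
      Real.one_le_rpow_of_pos_of_le_one_of_nonpos hl0 hl1 (by
        have : 0 < 1 / α := by positivity
        linarith)
    simp only [φ]
    rw [if_pos (ht.trans h1), max_eq_left (by linarith), sub_sub_cancel]
end

section
/- There exists a marginally stationary integer-valued AR(1) sequence (in the binomial thinning sense) X_n = ρ∘X_{n-1} + ε_n, 0 < ρ < 1, whose common marginal distribution is not infinitely divisible; e.g., the Sibuya(α,1) marginal with ρ = λ^{1/α}, λ ≤ (1-α)/(1+α). -/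
open MeasureTheory Set

noncomputable def wS : ℕ → ℝ
  | 0 => 0
  | n+1 => (catalan n : ℝ) / (2 * 4^n)

noncomputable def aS (n : ℕ) : ℝ := 3/4 * wS n + if n = 1 then 1/4 else 0

noncomputable def qS : ℕ → ℝ
  | 0 => 0
  | n+1 => (aS (n+1) - 1/16 * qS n) * (16/15)

lemma wS_nonneg (n : ℕ) : 0 ≤ wS n := by
  cases n <;> simp only [wS] <;> positivity

lemma wS_partial (n : ℕ) :
    ∑ k ∈ Finset.range n, wS (k+1) = 1 - (Nat.centralBinom n : ℝ) / 4^n := by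
  induction n with
  | zero => simp
  | succ n ih =>
    rw [Finset.sum_range_succ, ih]
    have h1 : ((n:ℝ)+1) * (Nat.centralBinom (n+1) : ℝ) = 2 * (2*n+1) * Nat.centralBinom n := by
      exact_mod_cast Nat.succ_mul_centralBinom_succ n
    have h2 : ((n:ℝ)+1) * (catalan n : ℝ) = Nat.centralBinom n := by
      exact_mod_cast succ_mul_catalan_eq_centralBinom n
    have h3 : (n:ℝ)+1 ≠ 0 := by positivity
    have h4 : (catalan n : ℝ) / 2 = Nat.centralBinom n - Nat.centralBinom (n+1) / 4 := by
      apply mul_left_cancel₀ h3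
      linear_combination h2 / 2 + h1 / 4
    have : wS (n+1) = ((catalan n : ℝ) / 2) / 4^n := by
      simp only [wS]; field_simp
    rw [this, h4, pow_succ]
    field_simp
    ring

lemma wS_summable' : Summable (fun n => wS (n+1)) := by
  refine summable_of_sum_range_le (c := 1) (fun n => wS_nonneg _) (fun n => ?_)
  rw [wS_partial]
  have : 0 ≤ (Nat.centralBinom n : ℝ) / 4^n := by positivity
  linarith

lemma wS_summable : Summable wS := (summable_nat_add_iff 1).1 wS_summable'

lemma summable_mul_pow {p : ℕ → ℝ} (hp : ∀ n, 0 ≤ p n) (h : Summable p) {s : ℝ}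
    (hs : s ∈ Icc (0:ℝ) 1) : Summable (fun n => p n * s^n) :=
  Summable.of_nonneg_of_le (fun n => mul_nonneg (hp n) (pow_nonneg hs.1 n))
    (fun n => mul_le_of_le_one_right (hp n) (pow_le_one₀ hs.1 hs.2)) h

lemma wS_le_one : ∑' n, wS n ≤ 1 := by
  rw [wS_summable.tsum_eq_zero_add]
  have : ∑' n, wS (n+1) ≤ 1 := by
    refine Real.tsum_le_of_sum_range_le (fun n => wS_nonneg _) (fun n => ?_)
    rw [wS_partial]
    have : 0 ≤ (Nat.centralBinom n : ℝ) / 4^n := by positivity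
    linarith
  simpa [wS] using this

lemma wS_gen {s : ℝ} (hs : s ∈ Icc (0:ℝ) 1) :
    ∑' n, wS n * s^n = 1 - √(1-s) := by
  have hsum := summable_mul_pow wS_nonneg wS_summable hs
  set W := ∑' n, wS n * s^n with hW
  have hW1 : W ≤ 1 := le_trans (hsum.tsum_le_tsum
    (fun n => mul_le_of_le_one_right (wS_nonneg n) (pow_le_one₀ hs.1 hs.2)) wS_summable) wS_le_one
  have hs' : Summable (fun n => wS (n+1) * s^n) := summable_mul_pow (fun n => wS_nonneg _) wS_summable' hs
  set V := ∑' n, wS (n+1) * s^n with hV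
  have hWV : W = s * V := by
    rw [hW, hsum.tsum_eq_zero_add, hV, ← tsum_mul_left]
    simp only [wS, zero_mul, zero_add]
    congr 1; ext n; ring
  have hVV : V = 1/2 + s/2 * V^2 := by
    have h2 : V^2 = ∑' n, 2 * (wS (n+2) * s^n) := by
      rw [sq, hV, tsum_mul_tsum_eq_tsum_sum_antidiagonal_of_summable_norm hs'.norm hs'.norm]
      congr 1; ext n
      have hc : (catalan (n+1) : ℝ) = ∑ ij ∈ Finset.HasAntidiagonal.antidiagonal n, (catalan ij.1 : ℝ) * catalan ij.2 := by
        exact_mod_cast catalan_succ' n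
      simp only [wS]
      rw [hc, Finset.sum_div, Finset.sum_mul, Finset.mul_sum]
      refine Finset.sum_congr rfl fun ij hij => ?_
      rw [← Finset.HasAntidiagonal.mem_antidiagonal.1 hij]
      simp only [pow_add, pow_one]
      field_simp
      ring
    rw [h2, tsum_mul_left]
    conv_lhs => rw [hV, hs'.tsum_eq_zero_add]
    rw [show s/2 * (2 * ∑' n, wS (n+2) * s^n) = s * ∑' n, wS (n+2) * s^n by ring, ← tsum_mul_left]
    congr 1
    · simp [wS]
    · congr 1; ext n; ring
  have hq : (1 - W)^2 = 1 - s := by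
    rw [hWV]; linear_combination (-2*s) * hVV
  rw [← hq, Real.sqrt_sq (by linarith)]; ring

lemma aS_nonneg (n : ℕ) : 0 ≤ aS n := by
  have := wS_nonneg n
  unfold aS; split_ifs <;> positivity

lemma catalan_mono (n : ℕ) : (catalan n : ℝ) ≤ catalan (n+1) := by
  have : catalan n ≤ catalan (n+1) := by
    rw [catalan_succ']
    have := Finset.single_le_sum (f := fun ij : ℕ × ℕ => catalan ij.1 * catalan ij.2)
      (s := Finset.HasAntidiagonal.antidiagonal n) (fun _ _ => Nat.zero_le _)
      (show (n, 0) ∈ Finset.HasAntidiagonal.antidiagonal n by simp)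
    simpa using this
  exact_mod_cast this

lemma aS_ratio (n : ℕ) : aS n / 15 ≤ aS (n+1) := by
  rcases n with _ | _ | n
  · have := aS_nonneg 1
    simpa [aS, wS] using this
  · simp [aS, wS]; norm_num
  · have h : wS (n+2) / 4 ≤ wS (n+3) := by
      simp only [wS]
      have := catalan_mono (n+1)
      rw [div_div, show (2:ℝ) * 4^(n+1) * 4 = 2 * 4^(n+2) by ring]
      gcongr
    have := wS_nonneg (n+2)
    simp [aS]
    linarith

lemma qS_bound (n : ℕ) : 0 ≤ qS n ∧ qS n ≤ 16/15 * aS n := by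
  induction n with
  | zero => simp [qS, aS, wS]
  | succ n ih =>
    have := aS_ratio n
    simp only [qS]
    constructor <;> linarith [ih.1, ih.2]

lemma aS_hasSum {s : ℝ} (hs : s ∈ Icc (0:ℝ) 1) :
    HasSum (fun n => aS n * s^n) (3/4 * (1 - √(1-s)) + 1/4 * s) := by
  have h1 := (summable_mul_pow wS_nonneg wS_summable hs).hasSum
  rw [wS_gen hs] at h1
  have h2 : HasSum (fun n : ℕ => (if n = 1 then (1/4 * s : ℝ) else 0)) (1/4 * s) := hasSum_ite_eq 1 _
  have h3 := (h1.mul_left (3/4)).add h2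
  refine (congrArg (fun f => HasSum f (3/4 * (1 - √(1-s)) + 1/4 * s)) (funext fun n => ?_)).mpr h3
  unfold aS
  split_ifs with h
  · subst h; ring
  · ring

lemma aS_summable : Summable aS := by
  simpa using (aS_hasSum (s := 1) (by simp)).summable

lemma qS_summable : Summable qS :=
  Summable.of_nonneg_of_le (fun n => (qS_bound n).1) (fun n => (qS_bound n).2)
    (aS_summable.mul_left _)

lemma qS_gen {s : ℝ} (hs : s ∈ Icc (0:ℝ) 1) :
    (15/16 + 1/16 * s) * ∑' n, qS n * s^n = 3/4 * (1 - √(1-s)) + 1/4 * s := by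
  have hq := summable_mul_pow (fun n => (qS_bound n).1) qS_summable hs
  have ha := aS_hasSum hs
  have h0 : ∑' n, qS n * s^n = ∑' n, qS (n+1) * s^(n+1) := by
    rw [hq.tsum_eq_zero_add]; simp [qS]
  have h1 : ∑' n, aS n * s^n = ∑' n, aS (n+1) * s^(n+1) := by
    rw [ha.summable.tsum_eq_zero_add]; simp [aS, wS]
  have hq' := (summable_nat_add_iff 1).2 hq
  rw [← ha.tsum_eq, h1, add_mul]
  conv_lhs => lhs; rw [h0]
  rw [← tsum_mul_left, ← tsum_mul_left, ← (hq'.mul_left _).tsum_add (hq.mul_left _)]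
  congr 1; ext n
  simp only [qS]; ring

/-- There is a marginally stationary integer-valued AR(1) scheme (binomial thinning:
`P(s) = P(1-ρ+ρs)·P_ε(s)`) whose common marginal law is not infinitely divisible;
e.g. the Sibuya(α,1) marginal `P(s) = 1-(1-s)^α`. -/
theorem stmt16 :
    ∃ (Pf Pε : ℝ → ℝ) (ρ : ℝ), IsPGF Pf ∧ IsPGF Pε ∧ 0 < ρ ∧ ρ < 1 ∧
      (∀ s ∈ Icc (0:ℝ) 1, Pf s = Pf (1 - ρ + ρ * s) * Pε s) ∧
      ¬ IsIDPGF Pf ∧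
      ∃ α : ℝ, 0 < α ∧ α < 1 ∧ ∀ s ∈ Icc (0:ℝ) 1, Pf s = 1 - (1 - s) ^ α := by
  have hr : ∀ x : ℝ, x ^ (1/2 : ℝ) = √x := fun x => (Real.sqrt_eq_rpow x).symm
  have hq1 : ∑' n, qS n = 1 := by
    have := qS_gen (s := 1) (by simp)
    simp at this
    linarith
  refine ⟨fun s => 1 - √(1-s), fun s => ∑' n, qS n * s^n, 1/16, ⟨wS, wS_nonneg, ?_, ?_⟩,
    ⟨qS, fun n => (qS_bound n).1, hq1, fun s _ => rfl⟩, by norm_num, by norm_num, ?_, ?_,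
    1/2, by norm_num, by norm_num, fun s _ => by rw [hr]⟩
  · simpa using wS_gen (s := 1) (by simp)
  · intro s hs; exact (wS_gen hs).symm
  · intro s hs
    have hg := qS_gen hs
    have hu := Real.sqrt_nonneg (1-s)
    have hu2 := Real.sq_sqrt (show 0 ≤ 1 - s by linarith [hs.2])
    have he : √(1 - (1 - 1/16 + 1/16 * s)) = 1/4 * √(1-s) := by
      rw [show 1 - (1 - 1/16 + 1/16 * s) = (1/4 * √(1-s))^2 by rw [mul_pow, hu2]; ring]
      exact Real.sqrt_sq (by positivity)
    simp only
    rw [he]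
    set u := √(1-s)
    set q := ∑' n, qS n * s^n
    have hs' : s = 1 - u^2 := by linarith
    have hne : (1 + 1/4 * u) ≠ 0 := by positivity
    apply mul_left_cancel₀ hne
    rw [hs'] at hg
    linear_combination -hg
  · intro h
    obtain ⟨Q, ⟨p, hp, hp1, hQ⟩, hPQ⟩ := h 2 (by norm_num)
    have hps : Summable p := by
      by_contra hc
      rw [tsum_eq_zero_of_not_summable hc] at hp1
      norm_num at hp1
    have h0 : Q 0 = 0 := by
      have := hPQ 0 (by simp)
      simpa using this.symm
    have hp0 : p 0 = 0 := by
      rw [hQ 0 (by simp), tsum_eq_single 0 (fun n hn => by simp [hn])] at h0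
      simpa using h0
    have hm : (1/4 : ℝ) ∈ Icc (0:ℝ) 1 := by constructor <;> norm_num
    have hle : Q (1/4) ≤ 1/4 := by
      rw [hQ _ hm]
      calc ∑' n, p n * (1/4:ℝ)^n ≤ ∑' n, p n * (1/4) := by
            refine (summable_mul_pow hp hps hm).tsum_le_tsum (fun n => ?_) (hps.mul_right _)
            rcases n with _ | n
            · simp [hp0]
            · refine mul_le_mul_of_nonneg_left ?_ (hp _)
              rw [pow_succ]
              exact mul_le_of_le_one_left hm.1 (pow_le_one₀ hm.1 hm.2)
        _ = 1/4 := by rw [tsum_mul_right, hp1, one_mul]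
    have hge : 0 ≤ Q (1/4) := by
      rw [hQ _ hm]
      exact tsum_nonneg fun n => mul_nonneg (hp n) (by positivity)
    have hP := hPQ _ hm
    simp only at hP
    have hsq : √(1 - 1/4 : ℝ) ≤ 7/8 := by
      rw [Real.sqrt_le_left (by norm_num)]; norm_num
    nlinarith
end
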